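/- Let p be an odd prime, n ≥ 1, and F a finite field with |F| = p^n. Write p^n − 1 = 2^(λ⁻) · ω⁻ and p^n + 1 = 2^(λ⁺) · ω⁺ with ω⁻ and ω⁺ odd, set λ_m = max(λ⁻, λ⁺), and let ω_m be the one of ω⁻, ω⁺ for which 2^(λ_m) · ω_m ∈ {p^n − 1, p^n + 1}. Then for every k with 2 ≤ k ≤ λ_m, the number of elements a ∈ F whose preperiod under the map f : F → F, f(x) = T_2(x) = x² − 2, equals k is 2^(k−2) · ω_m. -/

import Mathlib

open Polynomial Function

/-- The preperiod of `a` under `f` : the least `ρ ≥ 0` such that `f^[ρ] a` is a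
periodic point of `f`. -/
noncomputable def preperiod {S : Type*} (f : S → S) (a : S) : ℕ :=
  sInf {ρ : ℕ | f^[ρ] a ∈ Function.periodicPts f}

lemma add_inv_eq_add_inv_iff {K : Type*} [Field K] {z w : K} (hz : z ≠ 0)
    (hw : w ≠ 0) :
    w + w⁻¹ = z + z⁻¹ ↔ w = z ∨ w = z⁻¹ := by
  constructor
  · intro h
    have h' : (w - z) * (w * z - 1) = 0 := by
      field_simp at h
      linear_combination h
    rcases mul_eq_zero.mp h' with h1 | h1
    · exact Or.inl (sub_eq_zero.mp h1)
    · exact Or.inr (eq_inv_of_mul_eq_one_left (sub_eq_zero.mp h1))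
  · rintro (rfl | rfl)
    · rfl
    · rw [inv_inv, add_comm]

lemma eval_dickson_two {R : Type*} [CommRing R] (x : R) :
    (dickson 1 (1 : R) 2).eval x = x ^ 2 - 2 := by
  simp
  ring

section

variable {F K : Type*} [Field F] [Field K] [Algebra F K]

lemma algebraMap_iterate_dickson_two {z : K} (hz : z ≠ 0) {a : F}
    (ha : algebraMap F K a = z + z⁻¹) (j : ℕ) :
    algebraMap F K ((fun x : F => (dickson 1 (1 : F) 2).eval x)^[j] a) =
      z ^ 2 ^ j + (z ^ 2 ^ j)⁻¹ := by
  induction j with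
  | zero => simpa using ha
  | succ j ih =>
    have hz' : z ^ 2 ^ j ≠ 0 := pow_ne_zero _ hz
    rw [iterate_succ_apply', eval_dickson_two, map_sub, map_pow, ih, map_ofNat, pow_succ 2 j,
      pow_mul]
    field_simp
    ring

lemma mem_periodicPts_dickson_two_iff {z : K} (hz : z ≠ 0) {a : F}
    (ha : algebraMap F K a = z + z⁻¹) :
    a ∈ periodicPts (fun x : F => (dickson 1 (1 : F) 2).eval x) ↔ ∃ m, Odd m ∧ z ^ m = 1 := by
  have key (j : ℕ) : IsPeriodicPt (fun x : F => (dickson 1 (1 : F) 2).eval x) j a ↔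
      z ^ 2 ^ j = z ∨ z ^ 2 ^ j = z⁻¹ := by
    rw [← add_inv_eq_add_inv_iff hz (pow_ne_zero _ hz),
      ← algebraMap_iterate_dickson_two hz ha, ← ha,
      (algebraMap F K).injective.eq_iff]
    rfl
  constructor
  · rintro ⟨j, hj, h⟩
    have heven : Even (2 ^ j) := (even_two).pow_of_ne_zero hj.ne'
    rcases (key j).mp h with h | h
    · refine ⟨2 ^ j - 1, Nat.Even.sub_odd Nat.one_le_two_pow heven odd_one, ?_⟩
      rw [pow_sub₀ _ hz Nat.one_le_two_pow, h, pow_one, mul_inv_cancel₀ hz]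
    · exact ⟨2 ^ j + 1, heven.add_one, by rw [pow_succ, h, inv_mul_cancel₀ hz]⟩
  · rintro ⟨m, hm, h⟩
    refine ⟨m.totient, Nat.totient_pos.mpr hm.pos, (key _).mpr (Or.inl ?_)⟩
    have h2 : 2 ^ m.totient ≡ 1 [MOD m] :=
      Nat.ModEq.pow_totient (Nat.coprime_two_left.mpr hm)
    have := pow_mod_orderOf z (2 ^ m.totient)
    rw [← this, h2.of_dvd (orderOf_dvd_of_pow_eq_one h), pow_mod_orderOf, pow_one]

lemma preperiod_dickson_two_eq_succ_iff {z : K} (hz : z ≠ 0) {a : F}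
    (ha : algebraMap F K a = z + z⁻¹) (k : ℕ) :
    preperiod (fun x : F => (dickson 1 (1 : F) 2).eval x) a = k + 1 ↔
      (∃ m, Odd m ∧ z ^ (2 ^ (k + 1) * m) = 1) ∧ ¬ ∃ m, Odd m ∧ z ^ (2 ^ k * m) = 1 := by
  have key (j : ℕ) : (fun x : F => (dickson 1 (1 : F) 2).eval x)^[j] a ∈
      periodicPts (fun x : F => (dickson 1 (1 : F) 2).eval x) ↔
      ∃ m, Odd m ∧ z ^ (2 ^ j * m) = 1 := by
    simp_rw [pow_mul]
    exact mem_periodicPts_dickson_two_iff (pow_ne_zero _ hz)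
      (algebraMap_iterate_dickson_two hz ha j)
  rw [preperiod, Nat.sInf_upward_closed_eq_succ_iff]
  · simp only [Set.mem_ofPred_eq, key]
  · intro i j hij
    simp only [Set.mem_ofPred_eq, key]
    rintro ⟨m, hm, h⟩
    refine ⟨m, hm, ?_⟩
    obtain ⟨d, rfl⟩ := Nat.exists_eq_add_of_le hij
    rw [pow_add, mul_right_comm, pow_mul, h, one_pow]

end

lemma exists_odd_pow_eq_one_iff {G : Type*} [Monoid G] {z : G} {l w : ℕ} (hw : Odd w)
    (hz : z ^ (2 ^ l * w) = 1) (j : ℕ) :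
    (∃ m, Odd m ∧ z ^ (2 ^ j * m) = 1) ↔ z ^ (2 ^ j * w) = 1 := by
  refine ⟨?_, fun h => ⟨w, hw, h⟩⟩
  rintro ⟨m, hm, h⟩
  have hdvd : orderOf (z ^ 2 ^ j) ∣ 2 ^ l * w := orderOf_dvd_of_pow_eq_one <| by
    rw [← pow_mul, mul_comm, pow_mul, hz, one_pow]
  have hodd : Odd (orderOf (z ^ 2 ^ j)) :=
    hm.of_dvd_nat (orderOf_dvd_of_pow_eq_one (by rw [← pow_mul, h]))
  rw [pow_mul]
  exact orderOf_dvd_iff_pow_eq_one.mp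
    ((Nat.Coprime.pow_right l (Nat.coprime_two_right.mpr hodd)).dvd_of_dvd_mul_left hdvd)

lemma exists_add_inv_eq {K : Type*} [Field K] [IsAlgClosed K] (a : K) :
    ∃ z : K, z ≠ 0 ∧ a = z + z⁻¹ := by
  obtain ⟨z, hz⟩ := IsAlgClosed.exists_root (X ^ 2 - C a * X + 1 : K[X]) (by
    have : (X ^ 2 - C a * X + 1 : K[X]).degree = 2 := by compute_degree!
    rw [this]; decide)
  simp only [IsRoot.def, eval_add, eval_sub, eval_pow, eval_X, eval_mul, eval_C, eval_one] at hz
  have hz0 : z ≠ 0 := by rintro rfl; simp at hz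
  refine ⟨z, hz0, ?_⟩
  field_simp
  linear_combination -hz

lemma card_nthRootsFinset_one {K : Type*} [Field K] [IsAlgClosed K] {m : ℕ} (hm : (m : K) ≠ 0) :
    (nthRootsFinset m (1 : K)).card = m := by
  have : NeZero (m : K) := ⟨hm⟩
  obtain ⟨ζ, hζ⟩ := HasEnoughRootsOfUnity.exists_primitiveRoot K m
  exact hζ.card_nthRootsFinset

lemma mem_range_algebraMap_of_pow_card_eq {F K : Type*} [Field F] [Fintype F] [Field K]
    [Algebra F K] {x : K} (hx : x ^ Fintype.card F = x) : ∃ a : F, algebraMap F K a = x := by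
  have hsplits : (X ^ Fintype.card F - X : F[X]).Splits := by
    simpa using IsSplittingField.splits F (X ^ Fintype.card F - X : F[X])
  exact hsplits.mem_range_of_isRoot
    (FiniteField.X_pow_card_sub_X_ne_zero F Fintype.one_lt_card) (by simp [hx])

/-- Counting elements of preperiod `k + 2` when the `z` with `z + z⁻¹ ∈ F` are the roots of unity
of order dividing `2 ^ l * w` or `2 * w'`. -/
lemma ncard_preperiod_dickson_two {F K : Type*} [Field F] [Fintype F] [Field K] [Algebra F K]
    [IsAlgClosed K] {l w w' : ℕ} (hw : Odd w) (hw' : Odd w')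
    (hne : ((2 ^ l * w : ℕ) : K) ≠ 0)
    (hfix : ∀ z : K, z ≠ 0 → ((z ^ Fintype.card F = z ∨ z ^ Fintype.card F = z⁻¹) ↔
      (z ^ (2 ^ l * w) = 1 ∨ z ^ (2 * w') = 1))) {k : ℕ} (hk : k + 2 ≤ l) :
    {a : F | preperiod (fun x : F => (dickson 1 (1 : F) 2).eval x) a = k + 2}.ncard
      = 2 ^ k * w := by
  classical
  have hcast {j : ℕ} (hj : j ≤ l) : ((2 ^ j * w : ℕ) : K) ≠ 0 := by
    intro h
    obtain ⟨d, rfl⟩ := Nat.exists_eq_add_of_le hj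
    apply hne
    rw [pow_add, mul_right_comm, Nat.cast_mul, h, zero_mul]
  have hpos (j : ℕ) : 0 < 2 ^ j * w := Nat.mul_pos (by positivity) hw.pos
  set A := nthRootsFinset (2 ^ (k + 2) * w) (1 : K) \ nthRootsFinset (2 ^ (k + 1) * w) (1 : K)
    with hA
  have memA (z : K) : z ∈ A ↔ z ^ (2 ^ (k + 2) * w) = 1 ∧ ¬ z ^ (2 ^ (k + 1) * w) = 1 := by
    simp [hA, mem_nthRootsFinset (hpos _)]
  have ne_zero_of_mem {z : K} (hz : z ∈ A) : z ≠ 0 := by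
    rintro rfl
    have := ((memA 0).mp hz).1
    rw [zero_pow (hpos _).ne'] at this
    exact zero_ne_one this
  have hcardA : A.card = 2 ^ k * w * 2 := by
    rw [hA, Finset.card_sdiff_of_subset, card_nthRootsFinset_one (hcast hk),
      card_nthRootsFinset_one (hcast (by omega))]
    · rw [pow_add, pow_add, Nat.sub_eq_iff_eq_add (by gcongr <;> norm_num)]
      ring
    · intro z hz
      rw [mem_nthRootsFinset (hpos _)] at hz ⊢
      rw [pow_succ 2 (k + 1), mul_right_comm, pow_mul, hz, one_pow]
  have himage : (algebraMap F K) ''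
      {a : F | preperiod (fun x : F => (dickson 1 (1 : F) 2).eval x) a = k + 2} =
      (A.image fun z => z + z⁻¹ : Finset K) := by
    ext x
    simp only [Set.mem_image, Set.mem_ofPred_eq, Finset.coe_image, Finset.mem_coe]
    constructor
    · rintro ⟨a, ha, rfl⟩
      obtain ⟨z, hz, haz⟩ := exists_add_inv_eq (algebraMap F K a)
      refine ⟨z, ?_, haz.symm⟩
      rw [preperiod_dickson_two_eq_succ_iff hz haz] at ha
      have hq : z ^ Fintype.card F + (z ^ Fintype.card F)⁻¹ = z + z⁻¹ := by
        simpa [← haz, inv_pow] using (map_add (FiniteField.frobeniusAlgHom F K) z z⁻¹).symm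
      rcases (hfix z hz).mp ((add_inv_eq_add_inv_iff hz (pow_ne_zero _ hz)).mp hq) with h | h
      · rw [exists_odd_pow_eq_one_iff hw h, exists_odd_pow_eq_one_iff hw h] at ha
        exact (memA z).mpr ha
      · refine absurd ⟨w', hw', ?_⟩ ha.2
        rw [pow_succ, mul_assoc, mul_comm, pow_mul, h, one_pow]
    · rintro ⟨z, hzA, rfl⟩
      have hz := ne_zero_of_mem hzA
      have hzl : z ^ (2 ^ l * w) = 1 := by
        obtain ⟨d, rfl⟩ := Nat.exists_eq_add_of_le hk
        rw [pow_add, mul_right_comm, pow_mul, ((memA z).mp hzA).1, one_pow]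
      obtain ⟨a, ha⟩ := mem_range_algebraMap_of_pow_card_eq (F := F) (x := z + z⁻¹) (by
        refine (map_add (FiniteField.frobeniusAlgHom F K) z z⁻¹).trans ?_
        simp only [FiniteField.coe_frobeniusAlgHom, inv_pow]
        exact (add_inv_eq_add_inv_iff hz (pow_ne_zero _ hz)).mpr
          ((hfix z hz).mpr (Or.inl hzl)))
      refine ⟨a, ?_, ha⟩
      rw [preperiod_dickson_two_eq_succ_iff hz ha, exists_odd_pow_eq_one_iff hw hzl,
        exists_odd_pow_eq_one_iff hw hzl]
      exact (memA z).mp hzA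
  rw [← Set.ncard_image_of_injective _ (algebraMap F K).injective, himage, Set.ncard_coe_finset]
  apply Nat.eq_of_mul_eq_mul_right two_pos
  rw [← hcardA, Finset.card_eq_sum_card_image (fun z : K => z + z⁻¹) A, ← smul_eq_mul,
    ← Finset.sum_const]
  refine Finset.sum_congr rfl fun x hx => ?_
  obtain ⟨z, hzA, rfl⟩ := Finset.mem_image.mp hx
  have hz := ne_zero_of_mem hzA
  have hfiber : {y ∈ A | y + y⁻¹ = z + z⁻¹} = {z, z⁻¹} := by
    ext y
    simp only [Finset.mem_filter, Finset.mem_insert, Finset.mem_singleton]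
    constructor
    · rintro ⟨hyA, hy⟩
      exact (add_inv_eq_add_inv_iff hz (ne_zero_of_mem hyA)).mp hy
    · rintro (rfl | rfl)
      · exact ⟨hzA, rfl⟩
      · refine ⟨?_, by rw [inv_inv, add_comm]⟩
        simpa only [memA, inv_pow, inv_eq_one] using hzA
  rw [hfiber, Finset.card_pair]
  intro h
  refine ((memA z).mp hzA).2 ?_
  have hsq : z ^ 2 = 1 := by
    nth_rewrite 1 [pow_two]
    nth_rewrite 2 [h]
    exact mul_inv_cancel₀ hz
  rw [pow_succ, mul_assoc, mul_left_comm, pow_mul, hsq, one_pow]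

/-- Let p be an odd prime, F a finite field of order p^n, and write
p^n − 1 = 2^(λ⁻)·ω⁻, p^n + 1 = 2^(λ⁺)·ω⁺ with ω⁻, ω⁺ odd; put λ_m = max(λ⁻, λ⁺) and
let ω_m be such that 2^(λ_m)·ω_m ∈ {p^n − 1, p^n + 1}.  For every 2 ≤ k ≤ λ_m, the
number of a ∈ F with preperiod exactly k under f(x) = T₂(x) = x² − 2 is 2^(k−2)·ω_m. -/
theorem chebyshev_two_preperiod_count
    (p : ℕ) (hp : p.Prime) (hpodd : Odd p)
    (n : ℕ) (hn : 1 ≤ n)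
    (F : Type*) [Field F] [Fintype F] (hF : Fintype.card F = p ^ n)
    (lminus lplus wminus wplus : ℕ)
    (hminus : p ^ n - 1 = 2 ^ lminus * wminus)
    (hplus : p ^ n + 1 = 2 ^ lplus * wplus)
    (hwminus : Odd wminus) (hwplus : Odd wplus)
    (wmax : ℕ)
    (hwmax : 2 ^ max lminus lplus * wmax = p ^ n - 1 ∨
             2 ^ max lminus lplus * wmax = p ^ n + 1) :
    ∀ k : ℕ, 2 ≤ k → k ≤ max lminus lplus →
      {a : F | preperiod (fun x : F => (dickson 1 (1 : F) 2).eval x) a = k}.ncard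
        = 2 ^ (k - 2) * wmax := by
  intro k hk2 hk
  obtain ⟨k, rfl⟩ := Nat.exists_eq_add_of_le' hk2
  rw [Nat.add_sub_cancel]
  let K := AlgebraicClosure F
  have hq0 : ((p ^ n : ℕ) : K) = 0 := by
    rw [← hF, ← map_natCast (algebraMap F K), FiniteField.cast_card_eq_zero, map_zero]
  have hq1 : 1 ≤ p ^ n := Nat.one_le_pow _ _ hp.pos
  have hqodd : Odd (p ^ n) := hpodd.pow
  have hcastm : ((p ^ n - 1 : ℕ) : K) ≠ 0 := by
    rw [Nat.cast_sub hq1, hq0]; simp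
  have hcastp : ((p ^ n + 1 : ℕ) : K) ≠ 0 := by
    rw [Nat.cast_add, hq0]; simp
  have hm (z : K) (hz : z ≠ 0) : z ^ p ^ n = z ↔ z ^ (p ^ n - 1) = 1 := by
    rw [pow_sub₀ _ hz hq1, pow_one, mul_inv_eq_one₀ hz]
  have hp' (z : K) (hz : z ≠ 0) : z ^ p ^ n = z⁻¹ ↔ z ^ (p ^ n + 1) = 1 := by
    rw [pow_succ, ← mul_eq_one_iff_eq_inv₀ hz]
  have hdvd4 {l w : ℕ} (hl : 2 ≤ l) : 4 ∣ 2 ^ l * w :=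
    Dvd.dvd.mul_right (pow_dvd_pow 2 hl) w
  have eq_one {l w M : ℕ} (hM : M = 2 ^ l * w) (hw : Odd w) (h : M % 4 = 2) : l = 1 := by
    match l with
    | 0 => rw [pow_zero, one_mul] at hM; have := Nat.odd_iff.mp hw; omega
    | 1 => rfl
    | l + 2 => have := hdvd4 (w := w) (Nat.le_add_left 2 l); omega
  have hmax : 2 ≤ max lminus lplus := by omega
  have hdvd := hdvd4 (w := wmax) hmax
  have hmod := Nat.odd_iff.mp hqodd
  rcases (by omega : p ^ n % 4 = 1 ∨ p ^ n % 4 = 3) with h4 | h4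
  · obtain rfl := eq_one hplus hwplus (by omega)
    have hmax' : max lminus 1 = lminus := by omega
    rw [hmax'] at hk hwmax hdvd
    have heq : 2 ^ lminus * wmax = p ^ n - 1 := by omega
    obtain rfl : wmax = wminus :=
      Nat.eq_of_mul_eq_mul_left (by positivity) (heq.trans hminus)
    refine ncard_preperiod_dickson_two (K := K) hwminus hwplus (hminus ▸ hcastm) ?_ hk
    intro z hz
    rw [hF, hm z hz, hp' z hz, hminus, hplus, pow_one]
  · obtain rfl := eq_one hminus hwminus (by omega)
    have hmax' : max 1 lplus = lplus := by omega
    rw [hmax'] at hk hwmax hdvd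
    have heq : 2 ^ lplus * wmax = p ^ n + 1 := by omega
    obtain rfl : wmax = wplus :=
      Nat.eq_of_mul_eq_mul_left (by positivity) (heq.trans hplus)
    refine ncard_preperiod_dickson_two (K := K) hwplus hwminus (hplus ▸ hcastp) ?_ hk
    intro z hz
    rw [hF, hm z hz, hp' z hz, hminus, hplus, pow_one, or_comm]
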